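/- Let μ be a Radon measure on ℝⁿ (a Borel measure finite on compact sets), let 1 < p < ∞ and γ > 0, and let f ∈ L¹_loc(ℝⁿ,μ). For Q ∈ 𝒟 set a(f)_Q = ℓ(Q)^{γ/p} (1/μ(Q)) ∫_Q f dμ when μ(Q) > 0 and a(f)_Q = 0 otherwise. Then there is a constant C = C(n,p,γ) such that sup_{λ>0} λᵖ ∑_{Q∈𝒟 : |a(f)_Q| > λ} ℓ(Q)^{−γ} μ(Q) ≤ C · ∫_{ℝⁿ} |f|ᵖ dμ. -/

import Mathlib

open MeasureTheory Set
open scoped ENNReal Classical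

noncomputable section

/-- The half-open dyadic cube in `ℝⁿ` of generation `k` (sidelength `2 ^ k`) and
corner index `j`, i.e. `∏ᵢ [jᵢ 2ᵏ, (jᵢ+1) 2ᵏ)`. -/
def dyadicCube (n : ℕ) (k : ℤ) (j : Fin n → ℤ) : Set (Fin n → ℝ) :=
  Set.univ.pi fun i => Set.Ico ((j i : ℝ) * 2 ^ k) (((j i : ℝ) + 1) * 2 ^ k)

theorem measurableSet_dyadicCube (n : ℕ) (k : ℤ) (j : Fin n → ℤ) :
    MeasurableSet (dyadicCube n k j) :=
  MeasurableSet.univ_pi fun _ => measurableSet_Ico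

theorem measure_dyadicCube_lt_top {n : ℕ} (μ : Measure (Fin n → ℝ))
    [IsFiniteMeasureOnCompacts μ] (k : ℤ) (j : Fin n → ℤ) : μ (dyadicCube n k j) < ∞ := by
  refine lt_of_le_of_lt (measure_mono ?_)
    (isCompact_univ_pi fun i : Fin n =>
      isCompact_Icc (a := (j i : ℝ) * 2 ^ k) (b := ((j i : ℝ) + 1) * 2 ^ k)).measure_lt_top
  exact Set.pi_mono fun i _ => Ico_subset_Icc_self

/-- Distinct dyadic cubes of the same generation are disjoint. -/
theorem pairwise_disjoint_dyadicCube (n : ℕ) (k : ℤ) :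
    Pairwise (Function.onFun Disjoint (dyadicCube n k)) := by
  intro j j' hjj'
  refine Set.disjoint_left.2 fun x hx hx' => hjj' ?_
  funext i
  have h2 : (0 : ℝ) < 2 ^ k := by positivity
  obtain ⟨h₁, h₂⟩ := hx i (mem_univ i)
  obtain ⟨h₃, h₄⟩ := hx' i (mem_univ i)
  have hlt : j i < j' i + 1 := by
    exact_mod_cast lt_of_mul_lt_mul_right (h₁.trans_lt h₄) h2.le
  have hlt' : j' i < j i + 1 := by
    exact_mod_cast lt_of_mul_lt_mul_right (h₃.trans_lt h₂) h2.le
  omega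

/-- The part of a two-sided geometric series below a level `N` is dominated by `N`. -/
theorem tsum_zpow_lt_le {b L N : ℝ} (hb : 1 < b) (hL : 0 < L) (hN : 0 < N) :
    ∑' k : ℤ, (if L * b ^ (-k) < N then ENNReal.ofReal (L * b ^ (-k)) else 0) ≤
      ENNReal.ofReal (N / (1 - b⁻¹)) := by
  have hb0 : 0 < b := one_pos.trans hb
  obtain ⟨m, hm, hm'⟩ := exists_mem_Ico_zpow (div_pos hN hL) hb
  have hinj : Function.Injective fun i : ℕ => (i : ℤ) - m := fun i j hij => by
    simpa using hij
  rw [← hinj.tsum_eq]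
  · calc
      _ ≤ ∑' i : ℕ, ENNReal.ofReal (N * b⁻¹ ^ i) := by
          refine ENNReal.tsum_le_tsum fun i => ?_
          split_ifs
          · refine ENNReal.ofReal_le_ofReal ?_
            rw [neg_sub, zpow_sub₀ hb0.ne', zpow_natCast, inv_pow, div_eq_mul_inv, ← mul_assoc]
            have : L * b ^ m ≤ N := by rwa [le_div_iff₀' hL] at hm
            gcongr
          · exact zero_le
      _ = ENNReal.ofReal (N / (1 - b⁻¹)) := by
          have hr : b⁻¹ < 1 := inv_lt_one_of_one_lt₀ hb
          have hr0 : 0 ≤ b⁻¹ := by positivity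
          rw [← ENNReal.ofReal_tsum_of_nonneg (fun i => by positivity)
            ((summable_geometric_of_lt_one hr0 hr).mul_left N), tsum_mul_left,
            tsum_geometric_of_lt_one hr0 hr, div_eq_mul_inv]
  · intro k hk
    have hlt : L * b ^ (-k) < N := by
      by_contra h
      exact hk (if_neg h)
    have : b ^ (-k) < b ^ (m + 1) := by
      refine lt_trans ?_ hm'
      rwa [lt_div_iff₀' hL]
    have := (zpow_lt_zpow_iff_right₀ hb).1 this
    exact ⟨(k + m).toNat, by simp only; omega⟩

/-- `|y|` where `|y| > s`, and `0` elsewhere. -/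
def upperTruncation (s y : ℝ) : ℝ≥0∞ :=
  if s < |y| then ENNReal.ofReal |y| else 0

theorem measurable_upperTruncation (s : ℝ) : Measurable (upperTruncation s) :=
  Measurable.ite (measurableSet_lt measurable_const measurable_id.abs)
    measurable_id.abs.ennreal_ofReal measurable_const

theorem enorm_le_add_upperTruncation (s y : ℝ) :
    ‖y‖ₑ ≤ ENNReal.ofReal s + upperTruncation s y := by
  rw [← ofReal_norm, Real.norm_eq_abs, upperTruncation]
  split_ifs with h
  · exact le_add_self
  · simpa using ENNReal.ofReal_le_ofReal (not_lt.1 h)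

/-- If the average of `f` over `Q` exceeds `t` in absolute value, then the part of `f` above
the level `t / 2` already has integral at least `t / 2 * μ Q`. -/
theorem mul_measure_le_lintegral_upperTruncation {α : Type*} [MeasurableSpace α]
    {μ : Measure α} {Q : Set α} (hQ : μ Q ≠ ∞) {f : α → ℝ} {t : ℝ} (ht : 0 < t)
    (h : t < |⨍ x in Q, f x ∂μ|) :
    ENNReal.ofReal t * μ Q ≤ 2 * ∫⁻ x in Q, upperTruncation (t / 2) (f x) ∂μ := by
  have hhalf : ENNReal.ofReal t = ENNReal.ofReal (t / 2) + ENNReal.ofReal (t / 2) := by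
    rw [← ENNReal.ofReal_add (by positivity) (by positivity), add_halves]
  have hle : ENNReal.ofReal t * μ Q ≤ ‖∫ x in Q, f x ∂μ‖ₑ := by
    rw [← ofReal_norm, ← ENNReal.ofReal_toReal hQ, ← ENNReal.ofReal_mul ht.le]
    refine ENNReal.ofReal_le_ofReal ?_
    rw [setAverage_eq, smul_eq_mul, abs_mul, abs_inv, measureReal_def,
      abs_of_nonneg ENNReal.toReal_nonneg] at h
    rcases (ENNReal.toReal_nonneg (a := μ Q)).eq_or_lt with h0 | h0
    · simp [← h0]
    · rw [inv_mul_eq_div, lt_div_iff₀ h0] at h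
      exact h.le
  have hsum : ENNReal.ofReal (t / 2) * μ Q + ENNReal.ofReal (t / 2) * μ Q ≤
      ENNReal.ofReal (t / 2) * μ Q + ∫⁻ x in Q, upperTruncation (t / 2) (f x) ∂μ := by
    calc
      _ = ENNReal.ofReal t * μ Q := by rw [← add_mul, ← hhalf]
      _ ≤ ∫⁻ x in Q, ‖f x‖ₑ ∂μ := hle.trans (enorm_integral_le_lintegral_enorm _)
      _ ≤ ∫⁻ x in Q, (ENNReal.ofReal (t / 2) + upperTruncation (t / 2) (f x)) ∂μ :=
        lintegral_mono fun x => enorm_le_add_upperTruncation _ _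
      _ = _ := by rw [lintegral_add_left measurable_const, setLIntegral_const]
  have hfin : ENNReal.ofReal (t / 2) * μ Q ≠ ∞ := ENNReal.mul_ne_top ENNReal.ofReal_ne_top hQ
  rw [hhalf, add_mul, two_mul]
  have := (ENNReal.add_le_add_iff_left hfin).1 hsum
  gcongr

theorem tsum_upperTruncation_le {a p l : ℝ} (ha : 1 < a) (hp : 1 < p) (hl : 0 < l) (y : ℝ) :
    ∑' k : ℤ, ENNReal.ofReal ((l * a ^ (-k)) ^ (p - 1)) *
        (2 * upperTruncation (l * a ^ (-k) / 2) y) ≤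
      ENNReal.ofReal (2 ^ p / (1 - (a ^ (p - 1))⁻¹)) * ENNReal.ofReal (|y| ^ p) := by
  have ha0 : 0 < a := one_pos.trans ha
  have hq : 0 < p - 1 := sub_pos.2 hp
  rcases eq_or_ne y 0 with rfl | hy
  · have h0 (k : ℤ) : upperTruncation (l * a ^ (-k) / 2) 0 = 0 := by simp [upperTruncation]
    simp only [h0, mul_zero, tsum_zero, zero_le]
  have hy' : 0 < |y| := abs_pos.2 hy
  have hb : 1 < a ^ (p - 1) := Real.one_lt_rpow ha hq
  have hpow (k : ℤ) : (l * a ^ (-k)) ^ (p - 1) = l ^ (p - 1) * (a ^ (p - 1)) ^ (-k) := by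
    rw [Real.mul_rpow hl.le (by positivity), ← Real.rpow_intCast, ← Real.rpow_intCast,
      ← Real.rpow_mul ha0.le, ← Real.rpow_mul ha0.le, mul_comm (p - 1)]
  calc
    _ ≤ ∑' k : ℤ, ENNReal.ofReal (2 * |y|) *
          (if l ^ (p - 1) * (a ^ (p - 1)) ^ (-k) < (2 * |y|) ^ (p - 1) then
            ENNReal.ofReal (l ^ (p - 1) * (a ^ (p - 1)) ^ (-k)) else 0) := by
        refine ENNReal.tsum_le_tsum fun k => ?_
        rw [upperTruncation]
        split_ifs with h₁ h₂ h₂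
        · rw [hpow, ENNReal.ofReal_mul zero_le_two, ENNReal.ofReal_ofNat, mul_comm]
        · refine absurd ?_ h₂
          rw [← hpow]
          exact Real.rpow_lt_rpow (by positivity) (by linarith) hq
        · simp
        · simp
    _ ≤ ENNReal.ofReal (2 * |y|) *
          ENNReal.ofReal ((2 * |y|) ^ (p - 1) / (1 - (a ^ (p - 1))⁻¹)) := by
        rw [ENNReal.tsum_mul_left]
        gcongr
        exact tsum_zpow_lt_le hb (by positivity) (by positivity)
    _ = _ := by
        rw [← ENNReal.ofReal_mul (by positivity), ← ENNReal.ofReal_mul' (by positivity)]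
        congr 1
        have : (2 * |y|) * (2 * |y|) ^ (p - 1) = 2 ^ p * |y| ^ p := by
          rw [← Real.mul_rpow zero_le_two hy'.le, mul_comm, ← Real.rpow_add_one (by positivity),
            sub_add_cancel]
        rw [← mul_div_assoc, this, div_mul_eq_mul_div]

/-- for a Radon measure `μ`, `1 < p < ∞`, `γ > 0`, and `f ∈ L¹_loc(μ)`, with
`a(f)_Q = ℓ(Q)^{γ/p} ⨍_Q f dμ` (which is `0` when `μ(Q) = 0`), one has
`sup_{λ>0} λ^p ∑_{|a(f)_Q|>λ} ℓ(Q)^{-γ} μ(Q) ≤ C ∫ |f|^p dμ`. -/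
theorem statement7 (n : ℕ) (p γ : ℝ) (hp : 1 < p) (hγ : 0 < γ) :
    ∃ C : ℝ, 0 < C ∧
      ∀ (μ : Measure (Fin n → ℝ)), IsFiniteMeasureOnCompacts μ →
      ∀ f : (Fin n → ℝ) → ℝ, LocallyIntegrable f μ →
      (⨆ l ∈ Set.Ioi (0 : ℝ), ENNReal.ofReal (l ^ p) *
          ∑' Q : ℤ × (Fin n → ℤ),
            if l < |((2 : ℝ) ^ Q.1) ^ (γ / p) * ⨍ x in dyadicCube n Q.1 Q.2, f x ∂μ| then
              ENNReal.ofReal (((2 : ℝ) ^ Q.1) ^ (-γ)) * μ (dyadicCube n Q.1 Q.2) else 0)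
        ≤ ENNReal.ofReal C * ∫⁻ x, ENNReal.ofReal (|f x| ^ p) ∂μ := by
  set a : ℝ := 2 ^ (γ / p) with ha_def
  have hp0 : 0 < p := one_pos.trans hp
  have ha : 1 < a := Real.one_lt_rpow one_lt_two (div_pos hγ hp0)
  have ha0 : 0 < a := one_pos.trans ha
  have hb : 1 < a ^ (p - 1) := Real.one_lt_rpow ha (sub_pos.2 hp)
  refine ⟨2 ^ p / (1 - (a ^ (p - 1))⁻¹),
    div_pos (by positivity) (sub_pos.2 (inv_lt_one_of_one_lt₀ hb)), fun μ hμ f hf => ?_⟩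
  refine iSup₂_le fun l (hl : 0 < l) => ?_
  have hside (k : ℤ) : ((2 : ℝ) ^ k) ^ (γ / p) = a ^ k := by
    rw [ha_def, ← Real.rpow_intCast, ← Real.rpow_intCast, ← Real.rpow_mul zero_le_two,
      ← Real.rpow_mul zero_le_two, mul_comm]
  have hweight (k : ℤ) : l ^ p * ((2 : ℝ) ^ k) ^ (-γ) =
      (l * a ^ (-k)) ^ (p - 1) * (l * a ^ (-k)) := by
    have ht : 0 < l * a ^ (-k) := by positivity
    rw [← Real.rpow_add_one ht.ne', sub_add_cancel, Real.mul_rpow hl.le (by positivity),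
      zpow_neg, ← hside, ← Real.rpow_neg (by positivity), ← Real.rpow_mul (by positivity),
      neg_mul, div_mul_cancel₀ _ hp0.ne']
  have hcube (k : ℤ) (j : Fin n → ℤ) :
      ENNReal.ofReal (l ^ p) *
        (if l < |((2 : ℝ) ^ k) ^ (γ / p) * ⨍ x in dyadicCube n k j, f x ∂μ| then
          ENNReal.ofReal (((2 : ℝ) ^ k) ^ (-γ)) * μ (dyadicCube n k j) else 0) ≤
      ENNReal.ofReal ((l * a ^ (-k)) ^ (p - 1)) *
        (2 * ∫⁻ x in dyadicCube n k j, upperTruncation (l * a ^ (-k) / 2) (f x) ∂μ) := by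
    split_ifs with h
    · rw [hside, abs_mul, abs_of_pos (by positivity), ← div_lt_iff₀' (by positivity),
        div_eq_mul_inv, ← zpow_neg] at h
      rw [← mul_assoc, ← ENNReal.ofReal_mul (by positivity), hweight,
        ENNReal.ofReal_mul (by positivity), mul_assoc]
      refine mul_le_mul_right ?_ _
      exact mul_measure_le_lintegral_upperTruncation (measure_dyadicCube_lt_top μ k j).ne
        (by positivity) h
    · simp
  have hmeas (k : ℤ) :
      AEMeasurable (fun x => upperTruncation (l * a ^ (-k) / 2) (f x)) μ :=
    (measurable_upperTruncation _).comp_aemeasurable hf.aestronglyMeasurable.aemeasurable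
  calc
    _ ≤ ∑' Q : ℤ × (Fin n → ℤ), ENNReal.ofReal ((l * a ^ (-Q.1)) ^ (p - 1)) *
          (2 * ∫⁻ x in dyadicCube n Q.1 Q.2,
            upperTruncation (l * a ^ (-Q.1) / 2) (f x) ∂μ) := by
        rw [← ENNReal.tsum_mul_left]
        exact ENNReal.tsum_le_tsum fun Q => hcube Q.1 Q.2
    _ ≤ ∑' k : ℤ, ENNReal.ofReal ((l * a ^ (-k)) ^ (p - 1)) *
          (2 * ∫⁻ x, upperTruncation (l * a ^ (-k) / 2) (f x) ∂μ) := by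
        rw [ENNReal.tsum_prod']
        refine ENNReal.tsum_le_tsum fun k => ?_
        simp only
        rw [ENNReal.tsum_mul_left, ENNReal.tsum_mul_left,
          ← lintegral_iUnion (measurableSet_dyadicCube n k) (pairwise_disjoint_dyadicCube n k)]
        gcongr
        exact Measure.restrict_le_self
    _ = ∫⁻ x, ∑' k : ℤ, ENNReal.ofReal ((l * a ^ (-k)) ^ (p - 1)) *
          (2 * upperTruncation (l * a ^ (-k) / 2) (f x)) ∂μ := by
        rw [lintegral_tsum fun k => ((hmeas k).const_mul _).const_mul _]
        refine tsum_congr fun k => ?_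
        rw [lintegral_const_mul'' _ ((hmeas k).const_mul _), lintegral_const_mul'' _ (hmeas k)]
    _ ≤ ∫⁻ x, ENNReal.ofReal (2 ^ p / (1 - (a ^ (p - 1))⁻¹)) *
          ENNReal.ofReal (|f x| ^ p) ∂μ :=
        lintegral_mono fun x => tsum_upperTruncation_le ha hp hl (f x)
    _ = _ := lintegral_const_mul' _ _ ENNReal.ofReal_ne_top
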